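/- Let K/F_q be a quadratic étale algebra and n > 2. Then every transvection in the special unitary group SU_n(K/F_q) is conjugate within SU_n(K/F_q) to its inverse. -/

import Mathlib

open Matrix

universe u

section aux
variable {K : Type*} [CommRing K] [StarRing K] {n : ℕ}

theorem aux_pol (h2 : IsUnit (2 : K)) (δ : K) (hδ : star δ = -δ) (hδu : IsUnit δ)
    (A : Matrix (Fin n) (Fin n) K) (hA : A ≠ 0) :
    ∃ v : Fin n → K, star v ⬝ᵥ (A *ᵥ v) ≠ 0 := by
  by_contra! hc
  apply hA
  have key : ∀ u v : Fin n → K, star u ⬝ᵥ (A *ᵥ v) + star v ⬝ᵥ (A *ᵥ u) = 0 := by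
    intro u v
    have h := hc (u + v)
    simp only [star_add, add_dotProduct, mulVec_add, dotProduct_add, hc] at h
    linear_combination h
  have key2 : ∀ u v : Fin n → K, star u ⬝ᵥ (A *ᵥ v) = 0 := by
    intro u v
    have h1 := key u v
    have h3 := key u (δ • v)
    simp only [star_smul, smul_dotProduct, mulVec_smul, dotProduct_smul, hδ, smul_eq_mul] at h3
    have : (2 * δ) * (star u ⬝ᵥ (A *ᵥ v)) = 0 := by linear_combination h3 + δ * h1
    exact ((h2.mul hδu).mul_right_eq_zero).1 this
  ext i j
  have := key2 (Pi.single i 1) (Pi.single j 1)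
  have e : star (Pi.single i (1 : K) : Fin n → K) = Pi.single i 1 := by
    rw [← Pi.single_star]; simp
  rw [e] at this
  simpa using this

theorem aux_star_form (B : Matrix (Fin n) (Fin n) K) (u v : Fin n → K) :
    star (star u ⬝ᵥ (B *ᵥ v)) = star v ⬝ᵥ (Bᴴ *ᵥ u) := by
  have h : Bᴴ *ᵥ u = star (star u ᵥ* B) := by
    rw [star_vecMul, star_star]
  rw [dotProduct_mulVec, h, ← star_dotProduct_star]

/-- Hermitian of rank at most one. -/
theorem aux_rank_one [Nontrivial K] (h2 : IsUnit (2 : K)) (δ : K) (hδ : star δ = -δ)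
    (hδu : IsUnit δ)
    (hunit : ∀ c : K, star c = c → c ≠ 0 → IsUnit c)
    (A : Matrix (Fin n) (Fin n) K) (hA : A ≠ 0) (hAh : Aᴴ = A) (hr : A.rank ≤ 1) :
    ∃ (a : K) (w x : Fin n → K), IsUnit a ∧ star a = a ∧ star x ⬝ᵥ w = a ∧
      a • A = vecMulVec x (star x) := by
  obtain ⟨w, hw⟩ := aux_pol h2 δ hδ hδu A hA
  set a := star w ⬝ᵥ (A *ᵥ w) with ha
  have has : star a = a := by rw [ha, aux_star_form, hAh]
  have hau := hunit a has hw
  have hxs : star (A *ᵥ w) = star w ᵥ* A := by rw [star_mulVec, hAh]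
  refine ⟨a, w, A *ᵥ w, hau, has, ?_, ?_⟩
  · rw [hxs, ← dotProduct_mulVec]
  by_contra hne
  obtain ⟨u, hu⟩ := aux_pol h2 δ hδ hδu (a • A - vecMulVec (A *ᵥ w) (star (A *ᵥ w)))
    (sub_ne_zero.2 hne)
  set A' := a • A - vecMulVec (A *ᵥ w) (star (A *ᵥ w)) with hA'
  set b := star u ⬝ᵥ (A' *ᵥ u) with hb
  have hA'h : A'ᴴ = A' := by
    rw [hA', conjTranspose_sub, conjTranspose_smul, hAh, has, conjTranspose_vecMulVec, star_star]
  have hbu : IsUnit b := hunit b (by rw [hb, aux_star_form, hA'h]) hu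
  have hA'w : A' *ᵥ w = 0 := by
    rw [hA', sub_mulVec, smul_mulVec, vecMulVec_mulVec, hxs, ← dotProduct_mulVec, ← ha]
    simp
  have hwA' : ∀ v, star w ⬝ᵥ (A' *ᵥ v) = 0 := by
    intro v
    have := aux_star_form A' v w
    rw [hA'w, hA'h] at this
    simpa using this.symm
  -- A' u is in the range of A
  have hmem : A' *ᵥ u = A *ᵥ (a • u - (star (A *ᵥ w) ⬝ᵥ u) • w) := by
    rw [hA', sub_mulVec, smul_mulVec, vecMulVec_mulVec, mulVec_sub, mulVec_smul, mulVec_smul]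
    simp
  let f : Fin 2 → LinearMap.range A.mulVecLin :=
    ![⟨A *ᵥ w, w, rfl⟩, ⟨A' *ᵥ u, _, hmem.symm⟩]
  have hli : LinearIndependent K f := by
    rw [LinearIndependent.pair_iff]
    intro s t hst
    have hst' : s • (A *ᵥ w) + t • (A' *ᵥ u) = 0 := congrArg Subtype.val hst
    have h1 := congrArg (fun v => star w ⬝ᵥ v) hst'
    simp only [dotProduct_add, dotProduct_smul, hwA', ← ha, smul_eq_mul, mul_zero, add_zero,
      dotProduct_zero] at h1
    have hs : s = 0 := (hau.mul_left_eq_zero).1 h1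
    subst hs
    have h3 := congrArg (fun v => star u ⬝ᵥ v) hst'
    simp only [zero_smul, zero_add, dotProduct_smul, ← hb, smul_eq_mul, dotProduct_zero] at h3
    exact ⟨rfl, (hbu.mul_left_eq_zero).1 h3⟩
  have hfin : LinearIndependent K (fun i => (f i : Fin n → K)) :=
    hli.map' (Submodule.subtype _) (by simp)
  have hc := hli.cardinal_lift_le_rank
  have hlt : Module.rank K (LinearMap.range A.mulVecLin) < Cardinal.aleph0 := by
    refine lt_of_le_of_lt (Submodule.rank_le _) ?_
    exact Module.rank_lt_aleph0 K _
  have hfr : (A.rank : Cardinal) = Module.rank K (LinearMap.range A.mulVecLin) :=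
    Cardinal.cast_toNat_of_lt_aleph0 hlt
  rw [← hfr] at hc
  simp at hc
  have : (2:ℕ) ≤ A.rank := by exact_mod_cast hc
  omega

theorem aux_main [Nontrivial K] (h2 : IsUnit (2 : K)) (δ : K) (hδ : star δ = -δ)
    (hδu : IsUnit δ)
    (hunit : ∀ c : K, star c = c → c ≠ 0 → IsUnit c) (l : K) (hl : l * star l = -1)
    (hn : 2 < n) (J B : Matrix (Fin n) (Fin n) K) (hJ : Jᴴ = -J) (hJB : J * B = 1)
    (hBJ : B * J = 1)
    (N : Matrix (Fin n) (Fin n) K) (hNN : N * N = 0) (hN : N ≠ 0) (hr : N.rank ≤ 1)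
    (hU : (1 + N) * J * (1 + N)ᴴ = J) :
    ∃ h : Matrix (Fin n) (Fin n) K, h * J * hᴴ = J ∧ h.det = 1 ∧ h * N = - (N * h) := by
  have hB : Bᴴ = -B := by
    have h1 : Bᴴ * J = -1 := by
      have := congrArg conjTranspose hJB
      rw [conjTranspose_mul, hJ, conjTranspose_one, mul_neg] at this
      rw [← this, neg_neg]
    calc Bᴴ = Bᴴ * J * B := by rw [mul_assoc, hJB, mul_one]
      _ = -B := by rw [h1]; simp
  have hU' : N * J + J * Nᴴ + N * J * Nᴴ = 0 := by
    rw [conjTranspose_add, conjTranspose_one] at hU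
    have : (1 + N) * J * (1 + Nᴴ) = J + (N * J + J * Nᴴ + N * J * Nᴴ) := by noncomm_ring
    rw [this] at hU
    simpa using hU
  have hNJN : N * J * Nᴴ = 0 := by
    have := congrArg (fun M => N * M) hU'
    simp only [mul_add, ← mul_assoc, hNN, zero_mul, zero_add, add_zero, mul_zero] at this
    exact this
  set A := N * J with hA
  have hAh : Aᴴ = A := by
    rw [hNJN, add_zero] at hU'
    rw [hA, conjTranspose_mul, hJ, neg_mul]
    exact (eq_neg_of_add_eq_zero_left hU').symm
  have hNA : N = A * B := by rw [hA, mul_assoc, hJB, mul_one]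
  have hA0 : A ≠ 0 := fun h => hN (by rw [hNA, h, zero_mul])
  obtain ⟨a, w, x, hau, has, hxw, hAx⟩ := aux_rank_one h2 δ hδ hδu hunit A hA0 hAh
    ((rank_mul_le_left _ _).trans hr)
  obtain ⟨a', ha'⟩ := hau.exists_right_inv
  obtain ⟨c2, hc2⟩ := h2.exists_right_inv
  have hc2s : star c2 = c2 := by
    have h := congrArg star hc2
    simp only [star_mul, star_one, star_ofNat] at h
    linear_combination c2 * h - star c2 * hc2
  have hsf : ∀ u v : Fin n → K, star (star u ⬝ᵥ (B *ᵥ v)) = -(star v ⬝ᵥ (B *ᵥ u)) := by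
    intro u v; rw [aux_star_form, hB, neg_mulVec, dotProduct_neg]
  -- x is isotropic
  have hxx : star x ⬝ᵥ (B *ᵥ x) = 0 := by
    have h1 : A * B * A = 0 := by
      rw [← hNA, hA, ← mul_assoc, hNN, zero_mul]
    have h3 : vecMulVec x (star x) * B * vecMulVec x (star x) = 0 := by
      rw [← hAx]; simp [h1]
    have h4 := congrArg (fun M => star w ⬝ᵥ (M *ᵥ w)) h3
    have hwx : star w ⬝ᵥ x = a := by
      rw [← has, ← hxw, star_dotProduct, dotProduct_comm]
    simp only [← mulVec_mulVec, vecMulVec_mulVec, hxw, mulVec_smul, zero_mulVec,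
      dotProduct_zero, op_smul_eq_smul, dotProduct_smul, hwx, smul_eq_mul] at h4
    linear_combination (a' * a') * h4 - (star x ⬝ᵥ (B *ᵥ x)) * (a' * a + 1) * ha'
  -- y
  obtain ⟨y, hxy, hyy⟩ : ∃ y : Fin n → K, star x ⬝ᵥ (B *ᵥ y) = 1 ∧ star y ⬝ᵥ (B *ᵥ y) = 0 := by
    set y0 := J *ᵥ (a' • w) with hy0
    have e1 : star x ⬝ᵥ (B *ᵥ y0) = 1 := by
      rw [hy0, mulVec_mulVec, hBJ, one_mulVec, dotProduct_smul, hxw, smul_eq_mul, mul_comm, ha']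
    have e2 : star y0 ⬝ᵥ (B *ᵥ x) = -1 := by
      have := hsf x y0
      rw [e1, star_one] at this
      rw [this, neg_neg]
    set c := star y0 ⬝ᵥ (B *ᵥ y0) with hc
    have hcs : star c = -c := hsf y0 y0
    refine ⟨y0 + (c2 * c) • x, ?_, ?_⟩
    · simp only [mulVec_add, mulVec_smul, dotProduct_add, dotProduct_smul, e1, hxx, smul_zero,
        add_zero]
    · simp only [mulVec_add, mulVec_smul, dotProduct_add, dotProduct_smul, star_add, star_smul,
        add_dotProduct, smul_dotProduct, e1, e2, hxx, smul_eq_mul, star_mul', hc2s, hcs, ← hc]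
      linear_combination (-c) * hc2
  have hyx : star y ⬝ᵥ (B *ᵥ x) = -1 := by
    have := hsf x y
    rw [hxy, star_one] at this
    rw [this, neg_neg]
  -- z
  obtain ⟨z, hxz, hyz, hzz⟩ : ∃ z : Fin n → K, star x ⬝ᵥ (B *ᵥ z) = 0 ∧
      star y ⬝ᵥ (B *ᵥ z) = 0 ∧ star z ⬝ᵥ (B *ᵥ z) ≠ 0 := by
    set P : Matrix (Fin n) (Fin n) K :=
      1 + vecMulVec x (star y) * B - vecMulVec y (star x) * B with hP
    have hPv : ∀ v, P *ᵥ v = v + (star y ⬝ᵥ (B *ᵥ v)) • x - (star x ⬝ᵥ (B *ᵥ v)) • y := by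
      intro v
      simp only [hP, sub_mulVec, add_mulVec, one_mulVec, ← mulVec_mulVec, vecMulVec_mulVec,
        op_smul_eq_smul]
    have hBP : B * P ≠ 0 := by
      intro h0
      have hP0 : P = 0 := by rw [← one_mul P, ← hJB, mul_assoc, h0, mul_zero]
      have h1 : (1 : Matrix (Fin n) (Fin n) K) =
          (vecMulVec y (star x) - vecMulVec x (star y)) * B := by
        rw [sub_mul]
        have h3 : (1 : Matrix (Fin n) (Fin n) K) =
          P + (vecMulVec y (star x) * B - vecMulVec x (star y) * B) := by rw [hP]; abel
        rw [h3, hP0, zero_add]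
      have h4 : vecMulVec y (star x) - vecMulVec x (star y) =
          (Matrix.of ![y, x])ᵀ * (Matrix.of ![star x, -star y]) := by
        ext i j
        simp [Matrix.mul_apply, Fin.sum_univ_two, vecMulVec_apply, sub_eq_add_neg]
      have h5 : (1 : Matrix (Fin n) (Fin n) K).rank ≤ 2 := by
        rw [h1, h4, Matrix.mul_assoc]
        exact (rank_mul_le_left _ _).trans (by simpa using rank_le_width (Matrix.of ![y, x])ᵀ)
      rw [rank_one, Fintype.card_fin] at h5
      omega
    obtain ⟨v, hv⟩ := aux_pol h2 δ hδ hδu (B * P) hBP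
    have f1 : star x ⬝ᵥ (B *ᵥ (P *ᵥ v)) = 0 := by
      rw [hPv]
      simp only [mulVec_sub, mulVec_add, mulVec_smul, dotProduct_add, dotProduct_sub,
        dotProduct_smul, hxx, hxy, smul_eq_mul]
      ring
    have f2 : star y ⬝ᵥ (B *ᵥ (P *ᵥ v)) = 0 := by
      rw [hPv]
      simp only [mulVec_sub, mulVec_add, mulVec_smul, dotProduct_add, dotProduct_sub,
        dotProduct_smul, hyx, hyy, smul_eq_mul]
      ring
    refine ⟨P *ᵥ v, f1, f2, ?_⟩
    rw [← mulVec_mulVec] at hv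
    have : star (P *ᵥ v) ⬝ᵥ (B *ᵥ (P *ᵥ v)) = star v ⬝ᵥ (B *ᵥ (P *ᵥ v)) := by
      conv_lhs => rw [hPv v]
      simp only [star_add, star_sub, star_smul, add_dotProduct, sub_dotProduct, smul_dotProduct]
      rw [← hPv v, f1, f2]
      simp
    rwa [this]
  have hzx : star z ⬝ᵥ (B *ᵥ x) = 0 := by
    have := hsf x z
    rw [hxz, star_zero] at this
    exact neg_eq_zero.1 this.symm
  have hzy : star z ⬝ᵥ (B *ᵥ y) = 0 := by
    have := hsf y z
    rw [hyz, star_zero] at this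
    exact neg_eq_zero.1 this.symm
  set d := star z ⬝ᵥ (B *ᵥ z) with hd
  have hds : star d = -d := hsf z z
  have hdu : IsUnit d := by
    have h1 : δ * d ≠ 0 := fun h => hzz ((hδu.mul_right_eq_zero).1 h)
    have := hunit (δ * d) (by rw [star_mul', hδ, hds]; ring) h1
    exact isUnit_of_mul_isUnit_right this
  obtain ⟨d', hd'⟩ := hdu.exists_right_inv
  have hds' : star d' = -d' := by
    have h := congrArg star hd'
    simp only [star_mul', star_one, hds] at h
    linear_combination -d' * h - star d' * hd'
  set m := -(star l) ^ 2 with hm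
  have hms : star m = - l ^ 2 := by simp [hm]
  set U : Matrix (Fin n) (Fin 3) K := (Matrix.of ![x, y, z])ᵀ with hUdef
  set G : Matrix (Fin 3) (Fin 3) K := !![0, 1, 0; -1, 0, 0; 0, 0, d] with hG
  set E : Matrix (Fin 3) (Fin 3) K := !![0, 1 - l, 0; -l - 1, 0, 0; 0, 0, (m - 1) * d'] with hE
  have hUG : Uᴴ * B * U = G := by
    have hent : ∀ i j, (Uᴴ * B * U) i j = star (![x, y, z] i) ⬝ᵥ (B *ᵥ (![x, y, z] j)) := by
      intro i j
      rw [Matrix.mul_assoc]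
      rfl
    ext i j
    rw [hent]
    fin_cases i <;> fin_cases j <;> simp [hG, hxx, hxy, hxz, hyx, hyy, hyz, hzx, hzy, ← hd]
  have hEG : 1 + E * G = !![l, 0, 0; 0, -l, 0; 0, 0, m] := by
    ext i j
    fin_cases i <;> fin_cases j <;>
      simp [hE, hG, Matrix.mul_apply, Fin.sum_univ_three, Matrix.one_apply]
    linear_combination (m - 1) * hd'
  have hEE : E - Eᴴ - E * G * Eᴴ = 0 := by
    have h1 : E - Eᴴ - E * G * Eᴴ = E - (1 + E * G) * Eᴴ := by noncomm_ring
    have h3 : Eᴴ = !![0, -star l - 1, 0; 1 - star l, 0, 0; 0, 0, -((-l ^ 2 - 1) * d')] := by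
      ext i j
      fin_cases i <;> fin_cases j <;> simp [hE, hds', hms]
    rw [h1, hEG, h3, hE]
    ext i j
    fin_cases i <;> fin_cases j <;>
      simp [Matrix.mul_apply, Fin.sum_univ_three, hm]
    · linear_combination hl
    · linear_combination -hl
    · linear_combination (d' * (l * star l - 1)) * hl
  set h : Matrix (Fin n) (Fin n) K := 1 + U * E * Uᴴ * B with hh
  have hhJ : h * J * hᴴ = J := by
    have e1 : h * J = J + U * E * Uᴴ := by
      rw [hh, add_mul, one_mul, mul_assoc _ B J, hBJ, mul_one]
    have e2 : hᴴ = 1 - B * (U * Eᴴ * Uᴴ) := by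
      rw [hh]
      simp only [conjTranspose_add, conjTranspose_one, conjTranspose_mul,
        conjTranspose_conjTranspose, hB, Matrix.mul_assoc, neg_mul, sub_eq_add_neg]
    have e3 : (J + U * E * Uᴴ) * (1 - B * (U * Eᴴ * Uᴴ)) =
        J + U * (E - Eᴴ - E * (Uᴴ * B * U) * Eᴴ) * Uᴴ := by
      have : J * (B * (U * Eᴴ * Uᴴ)) = U * Eᴴ * Uᴴ := by rw [← mul_assoc, hJB, one_mul]
      rw [add_mul, mul_sub, mul_sub, this]
      simp only [Matrix.mul_sub, Matrix.sub_mul, Matrix.mul_assoc, Matrix.mul_one]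
      abel
    rw [e1, e2, e3, hUG, hEE]
    simp
  have hdet : h.det = 1 := by
    have e1 : h = 1 + U * (E * Uᴴ * B) := by rw [hh]; simp only [Matrix.mul_assoc]
    rw [e1, det_one_add_mul_comm]
    have e2 : E * Uᴴ * B * U = E * G := by rw [← hUG]; simp only [Matrix.mul_assoc]
    rw [e2, hEG]
    simp [det_fin_three, hm]
    linear_combination (l * star l - 1) * hl
  have hhx : h *ᵥ x = l • x := by
    have e1 : h * U = U * (1 + E * G) := by
      rw [hh, ← hUG]
      simp only [Matrix.mul_add, Matrix.add_mul, Matrix.mul_assoc, Matrix.mul_one, Matrix.one_mul]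
    have e2 : (h * U) *ᵥ (Pi.single 0 1) = (U * (1 + E * G)) *ᵥ (Pi.single 0 1) := by rw [e1]
    rw [hEG] at e2
    rw [← mulVec_mulVec] at e2
    have e3 : U *ᵥ (Pi.single 0 1) = x := by
      ext i; simp [hUdef]
    rw [e3] at e2
    rw [e2]
    ext i
    simp [hUdef, Matrix.mul_apply, Fin.sum_univ_three, mul_comm]
  refine ⟨h, hhJ, hdet, ?_⟩
  have hAA : h * A * hᴴ = -A := by
    have e1 : a • (h * A * hᴴ) = a • (-A) := by
      have : a • (h * A * hᴴ) = h * (a • A) * hᴴ := by simp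
      rw [this, smul_neg, hAx, mul_vecMulVec, vecMulVec_mul, ← star_mulVec, hhx, star_smul,
        vecMulVec_smul, smul_vecMulVec, smul_smul, mul_comm, hl]
      simp
    have := congrArg (fun M => a' • M) e1
    simpa only [smul_smul, mul_comm a' a, ha', one_smul] using this
  have hhu : IsUnit hᴴ := by
    rw [isUnit_iff_isUnit_det, det_conjTranspose, hdet]; simp
  have hJu : IsUnit J := ⟨⟨J, B, hJB, hBJ⟩, rfl⟩
  apply hJu.mul_right_cancel
  apply hhu.mul_right_cancel
  calc h * N * J * hᴴ = h * A * hᴴ := by rw [hA]; simp only [mul_assoc]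
    _ = -(N * J) := hAA
    _ = -(N * (h * J * hᴴ)) := by rw [hhJ]
    _ = _ := by simp only [mul_assoc, neg_mul]

end aux

/-- Let `K` be a quadratic étale algebra over a finite field `F` of odd order, with
nontrivial `F`-involution `σ` whose fixed points are exactly `F`, and let `J` be a
nondegenerate anti-Hermitian form on `K^n` with `n > 2`.  Then every transvection in the
special unitary group `SU_n(K/F)` is conjugate within `SU_n(K/F)` to its inverse. -/

theorem su_transvection_conjugate_inverse {F K : Type u} [Field F] [Fintype F]
    (hodd : Odd (Fintype.card F)) [CommRing K] [Algebra F K]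
    [Module.Free F K] (hrank : Module.finrank F K = 2) [Algebra.FormallyEtale F K]
    (σ : K ≃ₐ[F] K) (hσinv : ∀ x, σ (σ x) = x) (hσne : σ ≠ (AlgEquiv.refl : K ≃ₐ[F] K))
    (hfix : ∀ x : K, σ x = x → ∃ c : F, algebraMap F K c = x)
    {n : ℕ} (hn : 2 < n)
    (J : Matrix (Fin n) (Fin n) K) (hJah : (J.map ⇑σ)ᵀ = -J) (hJnd : IsUnit J)
    (g : (Matrix (Fin n) (Fin n) K)ˣ)
    (hgU : (g : Matrix (Fin n) (Fin n) K) * J * ((g : Matrix (Fin n) (Fin n) K).map ⇑σ)ᵀ = J)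
    (hgdet : (g : Matrix (Fin n) (Fin n) K).det = 1)
    (hguni : ((g : Matrix (Fin n) (Fin n) K) - 1) * ((g : Matrix (Fin n) (Fin n) K) - 1) = 0)
    (hgrank : ((g : Matrix (Fin n) (Fin n) K) - 1).rank = 1) :
    ∃ h : (Matrix (Fin n) (Fin n) K)ˣ,
      (h : Matrix (Fin n) (Fin n) K) * J * ((h : Matrix (Fin n) (Fin n) K).map ⇑σ)ᵀ = J ∧
        (h : Matrix (Fin n) (Fin n) K).det = 1 ∧ h * g * h⁻¹ = g⁻¹ := by
  classical
  haveI : Module.Finite F K := Module.finite_of_finrank_pos (by omega)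
  haveI : Nontrivial K := Module.nontrivial_of_finrank_pos (R := F) (by omega)
  haveI : IsReduced K := Algebra.FormallyUnramified.isReduced_of_field F K
  letI : StarRing K :=
    { star := σ
      star_involutive := hσinv
      star_mul := fun x y => by rw [map_mul, mul_comm]
      star_add := map_add σ }
  have hst : ∀ x : K, star x = σ x := fun _ => rfl
  have hchar : ringChar F ≠ 2 := by
    intro h
    have := FiniteField.even_card_of_char_two h
    rw [Nat.odd_iff] at hodd
    omega
  have h2F : (2 : F) ≠ 0 := Ring.two_ne_zero hchar
  have h2 : IsUnit (2 : K) := by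
    have := (IsUnit.mk0 (2 : F) h2F).map (algebraMap F K)
    rwa [map_ofNat] at this
  have hunit : ∀ c : K, star c = c → c ≠ 0 → IsUnit c := by
    intro c hc hc0
    obtain ⟨e, rfl⟩ := hfix c hc
    have he : e ≠ 0 := by rintro rfl; simp at hc0
    exact (IsUnit.mk0 e he).map (algebraMap F K)
  obtain ⟨δ, hδ, hδ0⟩ : ∃ δ : K, star δ = -δ ∧ δ ≠ 0 := by
    have : ∃ x, σ x ≠ x := by
      by_contra! hc
      exact hσne (AlgEquiv.ext hc)
    obtain ⟨x, hx⟩ := this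
    refine ⟨x - σ x, ?_, sub_ne_zero.2 hx.symm⟩
    rw [hst, map_sub, hσinv, neg_sub]
  have hδ2 : star (δ * δ) = δ * δ := by rw [star_mul', hδ]; ring
  have hδδ0 : δ * δ ≠ 0 := fun h => hδ0 (IsReduced.eq_zero δ ⟨2, by rw [pow_two, h]⟩)
  have hδu : IsUnit δ := isUnit_of_mul_isUnit_left (hunit _ hδ2 hδδ0)
  obtain ⟨D, hD⟩ := hfix _ hδ2
  have hD0 : D ≠ 0 := by rintro rfl; rw [map_zero] at hD; exact hδδ0 hD.symm
  obtain ⟨l, hl⟩ : ∃ l : K, l * star l = -1 := by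
    open Polynomial in
    obtain ⟨a, b, hab⟩ := FiniteField.exists_root_sum_quadratic (R := F)
      (f := C 1 * X ^ 2 + C 0 * X + C 1) (g := C (-D) * X ^ 2 + C 0 * X + C 0)
      (degree_quadratic one_ne_zero) (degree_quadratic (neg_ne_zero.2 hD0))
      (Nat.odd_iff.1 hodd)
    simp at hab
    refine ⟨algebraMap F K a + algebraMap F K b * δ, ?_⟩
    have h1 := congrArg (algebraMap F K) hab
    simp only [map_add, map_mul, map_pow, map_one, map_neg, map_zero, hD] at h1
    have e : ∀ c : F, star (algebraMap F K c) = algebraMap F K c := fun c => σ.commutes c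
    rw [star_add, star_mul', e, e, hδ]
    linear_combination h1
  obtain ⟨Ju, rfl⟩ := hJnd
  set N := (g : Matrix (Fin n) (Fin n) K) - 1 with hNdef
  have hgN : (g : Matrix (Fin n) (Fin n) K) = 1 + N := by rw [hNdef]; abel
  have hN0 : N ≠ 0 := by
    intro h0
    rw [h0, rank_zero] at hgrank
    omega
  rw [hgN] at hgU
  obtain ⟨h, hJ', hdet, hconj⟩ := aux_main h2 δ hδ hδu hunit l hl hn
    (Ju : Matrix (Fin n) (Fin n) K) (↑Ju⁻¹) hJah (by simp) (by simp) N hguni hN0 hgrank.le hgU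
  have hu : IsUnit h := by rw [isUnit_iff_isUnit_det, hdet]; exact isUnit_one
  obtain ⟨h, rfl⟩ := hu
  refine ⟨h, hJ', hdet, ?_⟩
  rw [mul_inv_eq_iff_eq_mul, eq_inv_mul_iff_mul_eq]
  ext1
  push_cast
  rw [hgN, mul_add, mul_one, hconj]
  have : (1 + N) * ((h : Matrix (Fin n) (Fin n) K) + -(N * h)) = h - N * N * h := by
    noncomm_ring
  rw [this, hguni]
  simp
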